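/- For μ^ℕ-almost every x ∈ Ω^ℕ the following holds: for every set S ⊆ [0,∞) that is a finite union of disjoint intervals with rational endpoints and every i ∈ ℕ₀, μ^k({ω ∈ Ω^k : M_k^x(S)(ω) = i}) converges to e^{−|S|} |S|^i / i! as k → ∞; equivalently, the random variables M_k^x(S) converge in distribution to a Poisson random variable with mean |S|. -/

import Mathlib

open MeasureTheory Filter

/-- The uniform product measure μ^k on Ω^k, Ω = Fin b: normalized counting measure. -/
noncomputable def muK (b k : ℕ) : Measure (Fin k → Fin b) :=
  ((b : ENNReal) ^ k)⁻¹ • Measure.count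

/-- ν is the product measure μ^ℕ of uniform measures on Ω = Fin b over Ω^ℕ:
every cylinder of length n has measure b^{-n}. -/
def IsUnifProductMeasure (b : ℕ) (ν : Measure (ℕ → Fin b)) : Prop :=
  ∀ (n : ℕ) (w : Fin n → Fin b),
    ν {x | ∀ t : Fin n, x (t : ℕ) = w t} = ((b : ENNReal)⁻¹) ^ n

/-- The word w (of length k) occurs in x at position j (positions numbered from 1):
I_j(x,w) = 1. -/
def OccursAt {b k : ℕ} (x : ℕ → Fin b) (j : ℕ) (w : Fin k → Fin b) : Prop :=
  ∀ t : Fin k, x (j - 1 + (t : ℕ)) = w t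

instance {b k : ℕ} (x : ℕ → Fin b) (j : ℕ) (w : Fin k → Fin b) :
    Decidable (OccursAt x j w) := by unfold OccursAt; infer_instance

/-- M_k^x(S)(w) = Σ_{j ∈ ℕ ∩ b^k S} I_j(x,w): the number of positive integers j with
j/b^k ∈ S at which w occurs in x. -/
noncomputable def Mx (b k : ℕ) (S : Set ℝ) (x : ℕ → Fin b) (w : Fin k → Fin b) : ℕ :=
  {j : ℕ | 1 ≤ j ∧ ((j : ℝ) / (b : ℝ) ^ k) ∈ S ∧ OccursAt x j w}.ncard

/-- Z^λ_{i,k}(x): proportion of words of length k occurring exactly i times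
among positions 1 ≤ j ≤ λ b^k of x. -/
noncomputable def Z (b k i : ℕ) (lam : ℝ) (x : ℕ → Fin b) : ℝ :=
  ((Finset.univ.filter (fun w : Fin k → Fin b =>
      ((Finset.Icc 1 ⌊lam * (b : ℝ) ^ k⌋₊).filter (fun j => OccursAt x j w)).card = i)).card : ℝ)
    / (b : ℝ) ^ k

/-- x is λ-Poisson generic. -/
def LamPoissonGeneric (b : ℕ) (lam : ℝ) (x : ℕ → Fin b) : Prop :=
  ∀ i : ℕ, Tendsto (fun k : ℕ => Z b k i lam x) atTop
    (nhds (Real.exp (-lam) * lam ^ i / (Nat.factorial i : ℝ)))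

/-- x is Poisson generic. -/
def PoissonGeneric (b : ℕ) (x : ℕ → Fin b) : Prop :=
  ∀ lam : ℝ, 0 < lam → LamPoissonGeneric b lam x

/-- S ⊆ [0,∞) is a finite union of pairwise disjoint intervals with rational endpoints. -/
def IsFinRatIntervalUnion (S : Set ℝ) : Prop :=
  ∃ (n : ℕ) (p q : Fin n → ℚ), (∀ m, 0 ≤ p m) ∧
    (Pairwise fun m l : Fin n =>
      Disjoint (Set.Ioo ((p m : ℝ)) ((q m : ℝ))) (Set.Ioo ((p l : ℝ)) ((q l : ℝ)))) ∧
    S = ⋃ m, Set.Ioo ((p m : ℝ)) ((q m : ℝ))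

/-- Total variation distance between two laws on ℕ (given as set functions). -/
noncomputable def dTV (P Q : Set ℕ → ℝ) : ℝ := ⨆ A : Set ℕ, |P A - Q A|

/-- The law on ℕ of M_k(S) under μ^ℕ × μ^k. -/
noncomputable def lawM (b k : ℕ) (ν : Measure (ℕ → Fin b)) (S : Set ℝ) (A : Set ℕ) : ℝ :=
  ((ν.prod (muK b k)) {p : (ℕ → Fin b) × (Fin k → Fin b) | Mx b k S p.1 p.2 ∈ A}).toReal

/-- The law on ℕ of M_k^x(S) under μ^k. -/
noncomputable def lawMx (b k : ℕ) (x : ℕ → Fin b) (S : Set ℝ) (A : Set ℕ) : ℝ :=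
  ((muK b k) {w : Fin k → Fin b | Mx b k S x w ∈ A}).toReal

/-- The Poisson law with mean λ, as a set function on ℕ. -/
noncomputable def poissonLaw (lam : ℝ) (A : Set ℕ) : ℝ :=
  ∑' i : A, Real.exp (-lam) * lam ^ (i : ℕ) / (Nat.factorial (i : ℕ) : ℝ)

open scoped Topology

section UniformProduct

variable {b : ℕ} {ν : Measure (ℕ → Fin b)}

/-- Extension of a finite word to a sequence by a constant symbol. -/
def extendWord (a : Fin b) {N : ℕ} (u : Fin N → Fin b) : ℕ → Fin b :=
  fun n => if h : n < N then u ⟨n, h⟩ else a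

theorem DependsOn.apply_extendWord {β : Type*} {F : (ℕ → Fin b) → β} {N : ℕ}
    (hF : DependsOn F (Set.Iio N)) (a : Fin b) (x : ℕ → Fin b) :
    F (extendWord a fun t : Fin N => x t) = F x :=
  hF fun n hn => by simp [extendWord, Set.mem_Iio.1 hn]

theorem extendWord_snoc_agree (a c : Fin b) {N : ℕ} (u : Fin N → Fin b) {n : ℕ} (hn : n < N) :
    extendWord a (Fin.snoc u c : Fin (N + 1) → Fin b) n = extendWord a u n := by
  simp [extendWord, hn, hn.trans (Nat.lt_succ_self N), Fin.snoc]

theorem extendWord_snoc_last (a c : Fin b) {N : ℕ} (u : Fin N → Fin b) :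
    extendWord a (Fin.snoc u c : Fin (N + 1) → Fin b) N = c := by
  simp [extendWord, Fin.snoc]

theorem DependsOn.measurable_of_Iio {β : Type*} [MeasurableSpace β] {F : (ℕ → Fin b) → β} {N : ℕ}
    (hF : DependsOn F (Set.Iio N)) : Measurable F := by
  rcases Nat.eq_zero_or_pos b with rfl | hb
  · exact measurable_of_empty F
  · have : F = (fun u : Fin N → Fin b => F (extendWord ⟨0, hb⟩ u)) ∘ fun x t => x t :=
      funext fun x => (hF.apply_extendWord ⟨0, hb⟩ x).symm
    rw [this]
    exact (measurable_of_finite _).comp (by fun_prop)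

theorem IsUnifProductMeasure.isProbabilityMeasure (hν : IsUnifProductMeasure b ν) :
    IsProbabilityMeasure ν :=
  ⟨by simpa using hν 0 Fin.elim0⟩

theorem IsUnifProductMeasure.integral_comp_restrict (hν : IsUnifProductMeasure b ν) {N : ℕ}
    (f : (Fin N → Fin b) → ℝ) :
    ∫ x, f (fun t => x t) ∂ν = (∑ u, f u) / (b : ℝ) ^ N := by
  have := hν.isProbabilityMeasure
  have hm : Measurable fun (x : ℕ → Fin b) (t : Fin N) => x t := by fun_prop
  have := Measure.isProbabilityMeasure_map (μ := ν) hm.aemeasurable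
  rw [← integral_map (f := f) hm.aemeasurable (measurable_of_finite f).aestronglyMeasurable,
    integral_fintype .of_finite, Finset.sum_div]
  refine Finset.sum_congr rfl fun u _ => ?_
  have hset : (fun (x : ℕ → Fin b) (t : Fin N) => x t) ⁻¹' {u} = {x | ∀ t : Fin N, x t = u t} := by
    ext x; simp [funext_iff]
  rw [map_measureReal_apply hm (measurableSet_singleton u), hset, measureReal_def, hν]
  simp [div_eq_inv_mul]

theorem IsUnifProductMeasure.measureReal_eq_card (hν : IsUnifProductMeasure b ν) (a : Fin b)
    {N : ℕ} {P : (ℕ → Fin b) → Prop} [DecidablePred P] (hP : DependsOn P (Set.Iio N)) :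
    ν.real {x | P x} =
      ((Finset.univ.filter fun u : Fin N → Fin b => P (extendWord a u)).card : ℝ) / (b : ℝ) ^ N := by
  have hS : MeasurableSet {x | P x} := measurableSet_setOfPred.2 hP.measurable_of_Iio
  rw [← integral_indicator_one hS, Finset.natCast_card_filter,
    ← hν.integral_comp_restrict fun u : Fin N → Fin b => if P (extendWord a u) then (1 : ℝ) else 0]
  congr 1
  ext x
  simp only [Set.indicator_apply, Set.mem_ofPred_eq, Pi.one_apply, hP.apply_extendWord a x]

/-- Given the past, the next symbol hits a prescribed value with probability `1 / b`. -/
theorem IsUnifProductMeasure.measureReal_and_eq (hν : IsUnifProductMeasure b ν) (a : Fin b)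
    {N : ℕ} {P : (ℕ → Fin b) → Prop} (hP : DependsOn P (Set.Iio N))
    {c : (ℕ → Fin b) → Fin b} (hc : DependsOn c (Set.Iio N)) :
    ν.real {x | P x ∧ x N = c x} = ν.real {x | P x} / b := by
  classical
  have hPc : DependsOn (fun x => P x ∧ x N = c x) (Set.Iio (N + 1)) := fun x y h => by
    have h' : ∀ n ∈ Set.Iio N, x n = y n := fun n hn => h n (Nat.lt_succ_of_lt hn)
    simp only [hP h', hc h', h N (Nat.lt_succ_self N)]
  rw [hν.measureReal_eq_card a hPc, hν.measureReal_eq_card a hP, div_div, pow_succ]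
  congr 2
  symm
  have hsn : ∀ (u : Fin N → Fin b) (d : Fin b), ∀ n ∈ Set.Iio N,
      extendWord a (Fin.snoc u d : Fin (N + 1) → Fin b) n = extendWord a u n :=
    fun u d n hn => extendWord_snoc_agree a d u hn
  refine Finset.card_bij'
    (fun (u : Fin N → Fin b) _ => (Fin.snoc u (c (extendWord a u)) : Fin (N + 1) → Fin b))
    (fun (v : Fin (N + 1) → Fin b) _ => (Fin.init v : Fin N → Fin b)) ?_ ?_ ?_ ?_
  · intro u hu
    simp only [Finset.mem_filter, Finset.mem_univ, true_and] at hu ⊢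
    rw [hP (hsn u _), hc (hsn u _)]
    exact ⟨hu, extendWord_snoc_last a _ u⟩
  · intro v hv
    simp only [Finset.mem_filter, Finset.mem_univ, true_and] at hv ⊢
    rw [← hP (hsn (Fin.init v) (v (Fin.last N))), Fin.snoc_init_self]
    exact hv.1
  · intro u _
    simp
  · intro v hv
    simp only [Finset.mem_filter, Finset.mem_univ, true_and] at hv
    have h1 := hc (hsn (Fin.init v) (v (Fin.last N)))
    have h2 := extendWord_snoc_last a (v (Fin.last N)) (Fin.init v)
    rw [Fin.snoc_init_self] at h1 h2
    rw [← h1, ← hv.2, h2, Fin.snoc_init_self]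

theorem IsUnifProductMeasure.symbol_nonempty (hν : IsUnifProductMeasure b ν) : Nonempty (Fin b) := by
  have := hν.isProbabilityMeasure
  exact (ν.nonempty_of_neZero).map fun x => x 0

end UniformProduct

section EfronStein

/-- A function of `N` symbols with differences bounded by `c` has variance at most `N * c ^ 2`. -/
theorem sum_sq_sub_mean_le_of_bounded_differences {b : ℕ} (hb : 0 < b) {c : ℝ} :
    ∀ {N : ℕ} (f : (Fin N → Fin b) → ℝ),
      (∀ (t : Fin N) (u : Fin N → Fin b) (a : Fin b), |f u - f (Function.update u t a)| ≤ c) →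
      ∑ u, (f u - (∑ v, f v) / (b : ℝ) ^ N) ^ 2 ≤ (b : ℝ) ^ N * (N * c ^ 2)
  | 0, f, _ => by simp
  | N + 1, f, hf => by
    have hb' : (b : ℝ) ≠ 0 := by positivity
    set g : (Fin N → Fin b) → ℝ := fun v => (∑ a, f (Fin.cons a v)) / b with hg
    have hsum (h : (Fin (N + 1) → Fin b) → ℝ) : ∑ u, h u = ∑ v, ∑ a, h (Fin.cons a v) := by
      rw [← (Fin.consEquiv fun _ : Fin (N + 1) => Fin b).sum_comp, Fintype.sum_prod_type_right]
      rfl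
    have hgsum (v : Fin N → Fin b) : ∑ a, f (Fin.cons a v) = b * g v := by
      simp only [hg]; field_simp
    have hgd : ∀ (t : Fin N) (v : Fin N → Fin b) (a : Fin b),
        |g v - g (Function.update v t a)| ≤ c := by
      intro t v a
      rw [hg]
      simp only
      rw [← sub_div, ← Finset.sum_sub_distrib, abs_div, abs_of_pos (by positivity : (0 : ℝ) < b),
        div_le_iff₀ (by positivity)]
      refine (Finset.abs_sum_le_sum_abs _ _).trans ((Finset.sum_le_card_nsmul _ _ c ?_).trans ?_)
      · intro d _
        rw [Fin.cons_update]
        exact hf _ _ _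
      · simp [mul_comm]
    have ih := sum_sq_sub_mean_le_of_bounded_differences hb g hgd
    have hmean : (∑ u, f u) / (b : ℝ) ^ (N + 1) = (∑ v, g v) / (b : ℝ) ^ N := by
      rw [hsum]
      simp only [hgsum, ← Finset.mul_sum]
      rw [pow_succ]
      field_simp
    rw [hmean, hsum]
    set m := (∑ v, g v) / (b : ℝ) ^ N
    have hfg : ∀ (v : Fin N → Fin b) (d : Fin b), (f (Fin.cons d v) - g v) ^ 2 ≤ c ^ 2 := by
      intro v d
      refine sq_le_sq.2 (le_trans ?_ (le_abs_self c))
      have : f (Fin.cons d v) - g v = (∑ a, (f (Fin.cons d v) - f (Fin.cons a v))) / b := by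
        rw [Finset.sum_sub_distrib, hgsum]
        simp; field_simp
      rw [this, abs_div, abs_of_pos (by positivity : (0 : ℝ) < b), div_le_iff₀ (by positivity)]
      refine (Finset.abs_sum_le_sum_abs _ _).trans ((Finset.sum_le_card_nsmul _ _ c ?_).trans ?_)
      · intro a _
        simpa using hf 0 (Fin.cons d v) a
      · simp [mul_comm]
    have hinner (v : Fin N → Fin b) :
        ∑ a, (f (Fin.cons a v) - m) ^ 2 ≤ b * c ^ 2 + b * (g v - m) ^ 2 := by
      have h1 : ∑ a, (f (Fin.cons a v) - m) ^ 2 =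
          ∑ a, (f (Fin.cons a v) - g v) ^ 2 + b * (g v - m) ^ 2 := by
        have h2 (a : Fin b) : (f (Fin.cons a v) - m) ^ 2 =
            (f (Fin.cons a v) - g v) ^ 2 + 2 * (g v - m) * f (Fin.cons a v)
              + ((g v - m) ^ 2 - 2 * (g v - m) * g v) := by ring
        simp only [h2, Finset.sum_add_distrib, ← Finset.mul_sum, hgsum]
        simp; ring
      rw [h1]
      gcongr
      refine (Finset.sum_le_card_nsmul _ _ (c ^ 2) fun a _ => hfg v a).trans ?_
      simp
    refine (Finset.sum_le_sum fun v _ => hinner v).trans ?_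
    rw [Finset.sum_add_distrib, ← Finset.mul_sum _ (fun v => (g v - m) ^ 2)]
    have : (b : ℝ) * ∑ v, (g v - m) ^ 2 ≤ b * ((b : ℝ) ^ N * (N * c ^ 2)) := by gcongr
    simp only [Finset.sum_const, Finset.card_univ, Fintype.card_fun, Fintype.card_fin,
      nsmul_eq_mul]
    push_cast
    rw [pow_succ (b : ℝ) N]
    linarith

theorem IsUnifProductMeasure.integral_sq_sub_mean_le {b : ℕ} {ν : Measure (ℕ → Fin b)}
    (hν : IsUnifProductMeasure b ν) {N : ℕ} {c : ℝ} {F : (ℕ → Fin b) → ℝ}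
    (hF : DependsOn F (Set.Iio N))
    (hd : ∀ (t : ℕ) (x : ℕ → Fin b) (a : Fin b), |F x - F (Function.update x t a)| ≤ c) :
    ∫ x, (F x - ∫ y, F y ∂ν) ^ 2 ∂ν ≤ N * c ^ 2 := by
  obtain ⟨a⟩ := hν.symbol_nonempty
  have hb : 0 < b := Fin.pos a
  set f : (Fin N → Fin b) → ℝ := fun u => F (extendWord a u) with hf
  have hFf : F = fun x => f fun t => x t := funext fun x => (hF.apply_extendWord a x).symm
  rw [hFf, hν.integral_comp_restrict f,
    hν.integral_comp_restrict fun u => (f u - (∑ v, f v) / (b : ℝ) ^ N) ^ 2,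
    div_le_iff₀ (by positivity), mul_comm]
  refine sum_sq_sub_mean_le_of_bounded_differences hb f fun t u d => ?_
  have : extendWord a (Function.update u t d) = Function.update (extendWord a u) t d := by
    ext n
    by_cases hn : n < N
    · by_cases hnt : n = t
      · subst hnt; simp [extendWord]
      · have : (⟨n, hn⟩ : Fin N) ≠ t := fun h => hnt (by rw [← h])
        simp [extendWord, hn, Function.update_of_ne hnt, Function.update_of_ne this]
    · have hnt : n ≠ t := by omega
      simp [extendWord, hn, Function.update_of_ne hnt]
  simp only [hf, this]
  exact hd _ _ _

end EfronStein

section Occurrences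

variable {b k : ℕ} {ν : Measure (ℕ → Fin b)}

/-- The number of positions in `J` at which the word `w` occurs in `x`. -/
def occCount (J : Finset ℕ) (x : ℕ → Fin b) (w : Fin k → Fin b) : ℕ :=
  (J.filter fun j => OccursAt x j w).card

theorem occCount_insert {J : Finset ℕ} {n : ℕ} (hn : n ∉ J) (x : ℕ → Fin b) (w : Fin k → Fin b) :
    occCount (insert n J) x w = occCount J x w + if OccursAt x n w then 1 else 0 := by
  unfold occCount
  rw [Finset.filter_insert]
  split_ifs with h
  · rw [Finset.card_insert_of_notMem (by simp [hn])]
  · simp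

theorem dependsOn_occursAt (j : ℕ) (w : Fin k → Fin b) :
    DependsOn (fun x : ℕ → Fin b => OccursAt x j w) (Set.Iio (j - 1 + k)) := fun x y h => by
  refine propext (forall_congr' fun t => ?_)
  rw [h (j - 1 + t) (by simp)]

theorem dependsOn_occCount {J : Finset ℕ} {N : ℕ} (hJ : ∀ j ∈ J, j - 1 + k ≤ N)
    (w : Fin k → Fin b) :
    DependsOn (fun x : ℕ → Fin b => occCount J x w) (Set.Iio N) := fun x y h => by
  refine congrArg Finset.card (Finset.filter_congr fun j hj => ?_)
  exact iff_of_eq (dependsOn_occursAt j w fun n hn => h n (lt_of_lt_of_le hn (hJ j hj)))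

theorem exists_forall_sub_one_add_le (J : Finset ℕ) (k : ℕ) : ∃ N, ∀ j ∈ J, j - 1 + k ≤ N :=
  ⟨J.sup fun j => j - 1 + k, fun _ hj => Finset.le_sup (f := fun j => j - 1 + k) hj⟩

theorem measurable_occCount (J : Finset ℕ) (w : Fin k → Fin b) :
    Measurable fun x : ℕ → Fin b => occCount J x w :=
  (dependsOn_occCount (exists_forall_sub_one_add_le J k).choose_spec w).measurable_of_Iio

theorem measurableSet_occursAt (j : ℕ) (w : Fin k → Fin b) :
    MeasurableSet {x : ℕ → Fin b | OccursAt x j w} :=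
  measurableSet_setOfPred.2 (dependsOn_occursAt j w).measurable_of_Iio

/-- An occurrence at position `j` is independent of the symbols before `j`. -/
theorem IsUnifProductMeasure.measureReal_and_occursAt (hν : IsUnifProductMeasure b ν) {j : ℕ}
    {P : (ℕ → Fin b) → Prop} (hP : DependsOn P (Set.Iio (j - 1))) :
    ∀ {k : ℕ} (w : Fin k → Fin b),
      ν.real {x | P x ∧ OccursAt x j w} = ν.real {x | P x} / (b : ℝ) ^ k
  | 0, w => by simp [OccursAt]
  | k + 1, w => by
    obtain ⟨a⟩ := hν.symbol_nonempty
    have hset : {x | P x ∧ OccursAt x j w} =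
        {x | (P x ∧ OccursAt x j (Fin.init w)) ∧ x (j - 1 + k) = w (Fin.last k)} := by
      ext x
      simp only [Set.mem_ofPred_eq, OccursAt, Fin.forall_fin_succ', and_assoc]
      rfl
    have hdep : DependsOn (fun x => P x ∧ OccursAt x j (Fin.init w)) (Set.Iio (j - 1 + k)) :=
      fun x y h => by
        have h1 := hP fun n hn => h n (lt_of_lt_of_le hn (Nat.le_add_right _ _))
        have h2 := dependsOn_occursAt j (Fin.init w) h
        simp only at h2
        simp only [h1, h2]
    rw [hset, hν.measureReal_and_eq a hdep (c := fun _ => w (Fin.last k)) fun _ _ _ => rfl,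
      hν.measureReal_and_occursAt hP, div_div, pow_succ]

theorem IsUnifProductMeasure.measureReal_occursAt (hν : IsUnifProductMeasure b ν) (j : ℕ)
    (w : Fin k → Fin b) : ν.real {x | OccursAt x j w} = 1 / (b : ℝ) ^ k := by
  have := hν.isProbabilityMeasure
  simpa using hν.measureReal_and_occursAt (j := j) (P := fun _ => True) (fun _ _ _ => rfl) w

/-- Two blocks of length `k` at distinct positions agree with probability `b ^ (-k)`,
even when they overlap. -/
theorem IsUnifProductMeasure.measureReal_blocks_eq (hν : IsUnifProductMeasure b ν) {i j : ℕ}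
    (hij : i < j) :
    ∀ k : ℕ, ν.real {x | ∀ t < k, x (j + t) = x (i + t)} = 1 / (b : ℝ) ^ k
  | 0 => by
    have := hν.isProbabilityMeasure
    simp
  | k + 1 => by
    obtain ⟨a⟩ := hν.symbol_nonempty
    have hset : {x : ℕ → Fin b | ∀ t < k + 1, x (j + t) = x (i + t)} =
        {x | (∀ t < k, x (j + t) = x (i + t)) ∧ x (j + k) = x (i + k)} := by
      ext x
      simp only [Set.mem_ofPred_eq, Nat.forall_lt_succ_right]
    have hdep : DependsOn (fun x : ℕ → Fin b => ∀ t < k, x (j + t) = x (i + t))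
        (Set.Iio (j + k)) := fun x y h => by
      refine propext (forall₂_congr fun t ht => ?_)
      rw [h (j + t) (by simpa using ht), h (i + t) (by simp; omega)]
    rw [hset, hν.measureReal_and_eq a hdep (c := fun x => x (i + k))
      (fun x y h => h (i + k) (by simpa using hij)), hν.measureReal_blocks_eq hij, div_div, pow_succ]

/-- Averaged over all words, occurrences at two distinct positions are independent. -/
theorem IsUnifProductMeasure.sum_measureReal_occursAt_and_occursAt_le
    (hν : IsUnifProductMeasure b ν) {i j : ℕ} (hi : 1 ≤ i) (hij : i < j) :
    ∑ w : Fin k → Fin b, ν.real {x | OccursAt x i w ∧ OccursAt x j w} ≤ 1 / (b : ℝ) ^ k := by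
  have := hν.isProbabilityMeasure
  rw [← hν.measureReal_blocks_eq (by omega : i - 1 < j - 1) k,
    ← measureReal_biUnion_finset (f := fun w : Fin k → Fin b =>
      {x | OccursAt x i w ∧ OccursAt x j w}) ?_
      fun w _ => (measurableSet_occursAt i w).inter (measurableSet_occursAt j w)]
  · refine measureReal_mono ?_
    simp only [Finset.mem_univ, Set.iUnion_true, Set.iUnion_subset_iff]
    rintro w x ⟨h1, h2⟩ t ht
    exact (h2 ⟨t, ht⟩).trans (h1 ⟨t, ht⟩).symm
  · intro w _ w' _ hww
    refine Set.disjoint_left.2 fun x hx hx' => hww (funext fun t => ?_)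
    exact (hx.1 t).symm.trans (hx'.1 t)

theorem occCount_filter_eq_or_exists (J : Finset ℕ) (p : ℕ → Prop) [DecidablePred p]
    (x : ℕ → Fin b) (w : Fin k → Fin b) :
    occCount (J.filter p) x w = occCount J x w ∨
      ∃ j ∈ J.filter fun j => ¬ p j, OccursAt x j w := by
  by_cases h : ∃ j ∈ J.filter fun j => ¬ p j, OccursAt x j w
  · exact Or.inr h
  · refine Or.inl (congrArg Finset.card ?_)
    ext j
    simp only [Finset.mem_filter, not_exists, not_and] at h ⊢
    exact ⟨fun hj => ⟨hj.1.1, hj.2⟩, fun hj => ⟨⟨hj.1, by_contra fun hp => h j ⟨hj.1, hp⟩ hj.2⟩, hj.2⟩⟩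

theorem abs_measureReal_occCount_sub_filter_le [IsProbabilityMeasure ν] (J : Finset ℕ)
    (p : ℕ → Prop) [DecidablePred p] (w : Fin k → Fin b) (i : ℕ) (Q : (ℕ → Fin b) → Prop) :
    |ν.real {x | occCount J x w = i ∧ Q x} - ν.real {x | occCount (J.filter p) x w = i ∧ Q x}| ≤
      ∑ j ∈ J.filter (fun j => ¬ p j), ν.real {x | OccursAt x j w ∧ Q x} := by
  have hle : ∀ A B : Set (ℕ → Fin b),
      A ⊆ B ∪ ⋃ j ∈ J.filter (fun j => ¬ p j), {x | OccursAt x j w ∧ Q x} →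
      ν.real A ≤ ν.real B +
        ∑ j ∈ J.filter (fun j => ¬ p j), ν.real {x | OccursAt x j w ∧ Q x} := fun A B h =>
    (measureReal_mono h).trans ((measureReal_union_le _ _).trans
      (by gcongr; exact measureReal_biUnion_finset_le _ _))
  rw [abs_sub_le_iff]
  constructor <;> rw [sub_le_iff_le_add'] <;> refine hle _ _ ?_ <;> rintro x ⟨hx, hQ⟩ <;>
    rcases occCount_filter_eq_or_exists J p x w with h | ⟨j, hj, h⟩
  · exact Or.inl ⟨h.trans hx, hQ⟩
  · exact Or.inr (Set.mem_biUnion hj ⟨h, hQ⟩)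
  · exact Or.inl ⟨h.symm.trans hx, hQ⟩
  · exact Or.inr (Set.mem_biUnion hj ⟨h, hQ⟩)

/-- The law of the number of occurrences in `J` of a uniformly random word of length `k`
in a `ν`-random sequence. -/
noncomputable def annealedLaw (ν : Measure (ℕ → Fin b)) (k : ℕ) (J : Finset ℕ) (i : ℕ) : ℝ :=
  (∑ w : Fin k → Fin b, ν.real {x | occCount J x w = i}) / (b : ℝ) ^ k

/-- The probability of having `i` occurrences in `J` and one at position `n`, for a uniformly random
word of length `k` in a `ν`-random sequence. -/
noncomputable def annealedJoint (ν : Measure (ℕ → Fin b)) (k : ℕ) (J : Finset ℕ) (n i : ℕ) : ℝ :=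
  (∑ w : Fin k → Fin b, ν.real {x | occCount J x w = i ∧ OccursAt x n w}) / (b : ℝ) ^ k

theorem IsUnifProductMeasure.abs_annealedJoint_sub_le (hν : IsUnifProductMeasure b ν)
    {J : Finset ℕ} {n : ℕ} (hJ : ∀ j ∈ J, 1 ≤ j) (hn : ∀ j ∈ J, j < n) (i : ℕ) :
    |annealedJoint ν k J n i - annealedLaw ν k J i / (b : ℝ) ^ k| ≤
      2 * k * (1 / (b : ℝ) ^ k) ^ 2 := by
  have := hν.isProbabilityMeasure
  obtain ⟨a⟩ := hν.symbol_nonempty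
  have hb : (0 : ℝ) < b := by exact_mod_cast Fin.pos a
  set D := J.filter (fun j => ¬ j + k ≤ n) with hD
  have hDk : (D.card : ℝ) ≤ k := by
    have hsub : D ⊆ Finset.Ico (n - k) n := by
      intro j hj
      rw [hD, Finset.mem_filter] at hj
      have := hn j hj.1
      simp only [Finset.mem_Ico]
      omega
    have := Finset.card_le_card hsub
    rw [Nat.card_Ico] at this
    exact_mod_cast (by omega : D.card ≤ k)
  have hw (w : Fin k → Fin b) :
      |ν.real {x | occCount J x w = i ∧ OccursAt x n w} -
        ν.real {x | occCount J x w = i} / (b : ℝ) ^ k| ≤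
      ∑ j ∈ D, ν.real {x | OccursAt x j w ∧ OccursAt x n w} + k * (1 / (b : ℝ) ^ k) ^ 2 := by
    have h1 := abs_measureReal_occCount_sub_filter_le (ν := ν) J (fun j => j + k ≤ n) w i
      fun x => OccursAt x n w
    have h2 := abs_measureReal_occCount_sub_filter_le (ν := ν) J (fun j => j + k ≤ n) w i
      fun _ => True
    have hdep : DependsOn (fun x : ℕ → Fin b => occCount (J.filter fun j => j + k ≤ n) x w = i)
        (Set.Iio (n - 1)) := fun x y h => by
      have := dependsOn_occCount (N := n - 1) (J := J.filter fun j => j + k ≤ n) (fun j hj => by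
        rw [Finset.mem_filter] at hj
        have := hJ j hj.1
        omega) w h
      simp only at this
      simp only [this]
    rw [hν.measureReal_and_occursAt hdep w] at h1
    simp only [and_true, hν.measureReal_occursAt, Finset.sum_const, nsmul_eq_mul] at h2
    rw [← hD] at h1 h2
    have h3 := h2.trans (mul_le_mul_of_nonneg_right hDk (by positivity))
    have h4 : |ν.real {x | occCount J x w = i} / (b : ℝ) ^ k -
        ν.real {x | occCount (J.filter fun j => j + k ≤ n) x w = i} / (b : ℝ) ^ k| ≤
        k * (1 / (b : ℝ) ^ k) ^ 2 := by
      rw [← sub_div, abs_div, abs_of_pos (by positivity : (0 : ℝ) < (b : ℝ) ^ k),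
        div_le_iff₀ (by positivity)]
      refine h3.trans (le_of_eq ?_)
      field_simp
    rw [abs_le] at *
    constructor <;> linarith [h1.1, h1.2, h4.1, h4.2]
  have havg : annealedJoint ν k J n i - annealedLaw ν k J i / (b : ℝ) ^ k =
      (∑ w : Fin k → Fin b, (ν.real {x | occCount J x w = i ∧ OccursAt x n w} -
        ν.real {x | occCount J x w = i} / (b : ℝ) ^ k)) / (b : ℝ) ^ k := by
    rw [Finset.sum_sub_distrib, ← Finset.sum_div, sub_div]
    rfl
  rw [havg, abs_div, abs_of_pos (by positivity : (0 : ℝ) < (b : ℝ) ^ k),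
    div_le_iff₀ (by positivity)]
  refine (Finset.abs_sum_le_sum_abs _ _).trans ((Finset.sum_le_sum fun w _ => hw w).trans ?_)
  rw [Finset.sum_add_distrib, Finset.sum_comm]
  have h5 : ∑ j ∈ D, ∑ w : Fin k → Fin b, ν.real {x | OccursAt x j w ∧ OccursAt x n w} ≤
      k * (1 / (b : ℝ) ^ k) := by
    refine (Finset.sum_le_card_nsmul _ _ (1 / (b : ℝ) ^ k) fun j hj => ?_).trans ?_
    · rw [hD, Finset.mem_filter] at hj
      exact hν.sum_measureReal_occursAt_and_occursAt_le (hJ j hj.1) (hn j hj.1)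
    · rw [nsmul_eq_mul]
      exact mul_le_mul_of_nonneg_right hDk (by positivity)
  refine (add_le_add_left h5 _).trans (le_of_eq ?_)
  simp only [Finset.sum_const, Finset.card_univ, Fintype.card_fun, Fintype.card_fin, nsmul_eq_mul]
  push_cast
  field_simp
  ring

theorem measureReal_occCount_insert [IsProbabilityMeasure ν] {J : Finset ℕ} {n : ℕ} (hn : n ∉ J)
    (w : Fin k → Fin b) (i : ℕ) :
    ν.real {x | occCount (insert n J) x w = i} =
      ν.real {x | occCount J x w = i} - ν.real {x | occCount J x w = i ∧ OccursAt x n w} +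
        ν.real {x | occCount J x w + 1 = i ∧ OccursAt x n w} := by
  rw [← measureReal_inter_add_sdiff (s := {x | occCount J x w = i}) (measurableSet_occursAt n w),
    ← measureReal_inter_add_sdiff (s := {x | occCount (insert n J) x w = i}) (measurableSet_occursAt n w)]
  have h1 : {x | occCount (insert n J) x w = i} ∩ {x | OccursAt x n w} =
      {x | occCount J x w + 1 = i ∧ OccursAt x n w} := by
    ext x
    simp only [occCount_insert hn, Set.mem_inter_iff, Set.mem_ofPred_eq]
    exact and_congr_left fun h => by simp [h]
  have h2 : {x | occCount (insert n J) x w = i} \ {x | OccursAt x n w} =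
      {x | occCount J x w = i} \ {x | OccursAt x n w} := by
    ext x
    simp only [occCount_insert hn, Set.mem_sdiff, Set.mem_ofPred_eq]
    exact and_congr_left fun h => by simp [h]
  rw [h1, h2, Set.ofPred_and (p := fun x => occCount J x w = i)]
  ring

theorem annealedLaw_insert_zero [IsProbabilityMeasure ν] {J : Finset ℕ} {n : ℕ} (hn : n ∉ J) :
    annealedLaw ν k (insert n J) 0 = annealedLaw ν k J 0 - annealedJoint ν k J n 0 := by
  simp only [annealedLaw, annealedJoint, measureReal_occCount_insert hn, ← sub_div,
    ← Finset.sum_sub_distrib]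
  simp

theorem annealedLaw_insert_succ [IsProbabilityMeasure ν] {J : Finset ℕ} {n : ℕ} (hn : n ∉ J)
    (i : ℕ) :
    annealedLaw ν k (insert n J) (i + 1) =
      annealedLaw ν k J (i + 1) - annealedJoint ν k J n (i + 1) + annealedJoint ν k J n i := by
  simp only [annealedLaw, annealedJoint, measureReal_occCount_insert hn, ← sub_div, ← add_div,
    ← Finset.sum_sub_distrib, ← Finset.sum_add_distrib, Nat.add_right_cancel_iff]

/-- The binomial probability mass function. -/
noncomputable def binomialMass (p : ℝ) (n i : ℕ) : ℝ := n.choose i * p ^ i * (1 - p) ^ (n - i)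

theorem binomialMass_succ_zero (p : ℝ) (n : ℕ) :
    binomialMass p (n + 1) 0 = (1 - p) * binomialMass p n 0 := by
  simp [binomialMass, pow_succ, mul_comm]

theorem binomialMass_succ_succ (p : ℝ) (n i : ℕ) :
    binomialMass p (n + 1) (i + 1) =
      (1 - p) * binomialMass p n (i + 1) + p * binomialMass p n i := by
  unfold binomialMass
  rw [Nat.choose_succ_succ, Nat.add_sub_add_right]
  rcases Nat.lt_or_ge i n with h | h
  · obtain ⟨m, rfl⟩ := Nat.exists_eq_add_of_lt h
    rw [show i + m + 1 - i = m + 1 by omega, show i + m + 1 - (i + 1) = m by omega]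
    push_cast
    ring
  · rw [Nat.choose_eq_zero_of_lt (by omega : n < i + 1)]
    push_cast
    ring

/-- The annealed law is close to a binomial law. -/
theorem IsUnifProductMeasure.abs_annealedLaw_sub_binomialMass_le (hν : IsUnifProductMeasure b ν)
    (J : Finset ℕ) (hJ : ∀ j ∈ J, 1 ≤ j) (i : ℕ) :
    |annealedLaw ν k J i - binomialMass (1 / (b : ℝ) ^ k) J.card i| ≤
      J.card * (4 * k * (1 / (b : ℝ) ^ k) ^ 2) := by
  have := hν.isProbabilityMeasure
  obtain ⟨a⟩ := hν.symbol_nonempty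
  have hb : (1 : ℝ) ≤ b := by exact_mod_cast Fin.pos a
  set p := 1 / (b : ℝ) ^ k with hp
  have hp0 : 0 ≤ p := by positivity
  have hp1 : p ≤ 1 := by
    rw [hp, div_le_one (by positivity)]
    exact one_le_pow₀ hb
  induction J using Finset.induction_on_max generalizing i with
  | empty =>
    rcases i with _ | i
    · simp [annealedLaw, binomialMass, occCount]
      have : (b : ℝ) ^ k ≠ 0 := by positivity
      simp [div_self this]
    · simp [annealedLaw, binomialMass, occCount]
  | insert n J hn ih =>
    have hnJ : n ∉ J := fun h => lt_irrefl n (hn n h)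
    have hJ' : ∀ j ∈ J, 1 ≤ j := fun j hj => hJ j (Finset.mem_insert_of_mem hj)
    have hstep (i : ℕ) : |annealedJoint ν k J n i - p * annealedLaw ν k J i| ≤ 2 * k * p ^ 2 := by
      have := hν.abs_annealedJoint_sub_le (k := k) hJ' hn i
      rwa [div_eq_mul_one_div, mul_comm (annealedLaw ν k J i)] at this
    have ih := ih hJ'
    rw [Finset.card_insert_of_notMem hnJ]
    push_cast
    set E := (J.card : ℝ) * (4 * k * p ^ 2)
    have hE : 0 ≤ 2 * k * p ^ 2 := by positivity
    have hq : 0 ≤ 1 - p := by linarith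
    rcases i with _ | i
    · rw [annealedLaw_insert_zero hnJ, binomialMass_succ_zero]
      have h1 := abs_le.1 (hstep 0)
      have h2 := abs_le.1 (ih 0)
      have hE0 : 0 ≤ E := by positivity
      rw [abs_le]
      constructor <;> nlinarith
    · rw [annealedLaw_insert_succ hnJ, binomialMass_succ_succ]
      have h1 := abs_le.1 (hstep i)
      have h2 := abs_le.1 (ih i)
      have h3 := abs_le.1 (hstep (i + 1))
      have h4 := abs_le.1 (ih (i + 1))
      rw [abs_le]
      constructor <;> nlinarith

end Occurrences

section PoissonLimit

theorem tendsto_natSub_mul {N : ℕ → ℕ} {p : ℕ → ℝ} {r : ℝ} (hp0 : ∀ k, 0 ≤ p k)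
    (hp : Tendsto p atTop (𝓝 0)) (hr : Tendsto (fun k => N k * p k) atTop (𝓝 r)) (i : ℕ) :
    Tendsto (fun k => ((N k - i : ℕ) : ℝ) * p k) atTop (𝓝 r) := by
  have hlow : Tendsto (fun k => N k * p k - i * p k) atTop (𝓝 r) := by
    simpa using hr.sub (hp.const_mul (i : ℝ))
  refine tendsto_of_tendsto_of_tendsto_of_le_of_le hlow hr (fun k => ?_) (fun k => ?_)
  · have : (N k : ℝ) ≤ (N k - i : ℕ) + i := by exact_mod_cast (by omega : N k ≤ N k - i + i)
    have := mul_le_mul_of_nonneg_right this (hp0 k)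
    simp only
    linarith
  · exact mul_le_mul_of_nonneg_right (Nat.cast_le.2 (Nat.sub_le _ _)) (hp0 k)

theorem tendsto_one_sub_pow_exp {N : ℕ → ℕ} {p : ℕ → ℝ} {r : ℝ}
    (hp : Tendsto p atTop (𝓝 0)) (hr : Tendsto (fun k => N k * p k) atTop (𝓝 r)) :
    Tendsto (fun k => (1 - p k) ^ N k) atTop (𝓝 (Real.exp (-r))) := by
  have h1 : Tendsto (fun k => Real.exp (-(N k * p k))) atTop (𝓝 (Real.exp (-r))) :=
    (Real.continuous_exp.tendsto _).comp hr.neg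
  have h2 : Tendsto (fun k => Real.exp (-(N k * p k / (1 - p k)))) atTop (𝓝 (Real.exp (-r))) := by
    refine (Real.continuous_exp.tendsto _).comp (Tendsto.neg ?_)
    have h := hr.div (tendsto_const_nhds.sub hp : Tendsto (fun k => 1 - p k) atTop (𝓝 (1 - 0)))
      (by norm_num)
    rwa [sub_zero, div_one] at h
  have hlt : ∀ᶠ k in atTop, p k < 1 := hp.eventually (gt_mem_nhds one_pos)
  refine tendsto_of_tendsto_of_tendsto_of_le_of_le' h2 h1 ?_ ?_
  · filter_upwards [hlt] with k hk
    have hq : 0 < 1 - p k := by linarith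
    have : Real.exp (-(p k / (1 - p k))) ≤ 1 - p k := by
      rw [Real.exp_neg, inv_le_comm₀ (Real.exp_pos _) hq]
      refine le_trans (le_of_eq ?_) (Real.add_one_le_exp _)
      field_simp
      ring
    calc Real.exp (-(N k * p k / (1 - p k))) = Real.exp (-(p k / (1 - p k))) ^ N k := by
          rw [← Real.exp_nat_mul]; congr 1; ring
      _ ≤ _ := pow_le_pow_left₀ (Real.exp_pos _).le this _
  · filter_upwards [hlt] with k hk
    calc (1 - p k) ^ N k ≤ Real.exp (-p k) ^ N k :=
          pow_le_pow_left₀ (by linarith) (Real.one_sub_le_exp_neg _) _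
      _ = _ := by rw [← Real.exp_nat_mul]; congr 1; ring

/-- **Poisson limit theorem** for binomial laws along an arbitrary sequence of parameters. -/
theorem tendsto_binomialMass {N : ℕ → ℕ} {p : ℕ → ℝ} {r : ℝ} (hp0 : ∀ k, 0 ≤ p k)
    (hp : Tendsto p atTop (𝓝 0)) (hr : Tendsto (fun k => N k * p k) atTop (𝓝 r)) (i : ℕ) :
    Tendsto (fun k => binomialMass (p k) (N k) i) atTop
      (𝓝 (Real.exp (-r) * r ^ i / (i.factorial : ℝ))) := by
  have h1 : Tendsto (fun k => ((N k).choose i : ℝ) * p k ^ i) atTop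
      (𝓝 (r ^ i / (i.factorial : ℝ))) := by
    have h : Tendsto (fun k => (∏ j ∈ Finset.range i, ((N k - j : ℕ) : ℝ) * p k) / i.factorial)
        atTop (𝓝 ((∏ _j ∈ Finset.range i, r) / i.factorial)) :=
      (tendsto_finsetProd _ fun j _ => tendsto_natSub_mul hp0 hp hr j).div_const _
    rw [Finset.prod_const, Finset.card_range] at h
    refine h.congr fun k => ?_
    rw [Finset.prod_mul_distrib, Finset.prod_const, Finset.card_range, ← Nat.cast_prod,
      ← Nat.descFactorial_eq_prod_range, Nat.descFactorial_eq_factorial_mul_choose]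
    have : (i.factorial : ℝ) ≠ 0 := by positivity
    push_cast
    field_simp
  have h2 := tendsto_one_sub_pow_exp hp (tendsto_natSub_mul hp0 hp hr i)
  have h3 := h1.mul h2
  rwa [mul_comm, ← mul_div_assoc] at h3

end PoissonLimit

section WordFrequency

variable {b k : ℕ} {ν : Measure (ℕ → Fin b)}

/-- The proportion of words of length `k` with exactly `i` occurrences in `x` at positions
in `J`. -/
noncomputable def wordFreq (k : ℕ) (J : Finset ℕ) (i : ℕ) (x : ℕ → Fin b) : ℝ :=
  ((Finset.univ.filter fun w : Fin k → Fin b => occCount J x w = i).card : ℝ) / (b : ℝ) ^ k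

theorem dependsOn_wordFreq {J : Finset ℕ} {N : ℕ} (hJ : ∀ j ∈ J, j - 1 + k ≤ N) (i : ℕ) :
    DependsOn (wordFreq (b := b) k J i) (Set.Iio N) := fun x y h => by
  have hxy (w : Fin k → Fin b) : occCount J x w = occCount J y w := dependsOn_occCount hJ w h
  simp only [wordFreq, hxy]

theorem IsUnifProductMeasure.integral_wordFreq (hν : IsUnifProductMeasure b ν) (J : Finset ℕ)
    (i : ℕ) : ∫ x, wordFreq k J i x ∂ν = annealedLaw ν k J i := by
  have := hν.isProbabilityMeasure
  have hS (w : Fin k → Fin b) : MeasurableSet {x : ℕ → Fin b | occCount J x w = i} :=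
    measurable_occCount J w (measurableSet_singleton i)
  have h : wordFreq (b := b) k J i = fun x =>
      (∑ w : Fin k → Fin b, {x | occCount J x w = i}.indicator (1 : (ℕ → Fin b) → ℝ) x) /
        (b : ℝ) ^ k := by
    ext x
    simp [wordFreq, Set.indicator_apply]
  rw [h, integral_div, integral_finsetSum]
  · simp only [integral_indicator_one (hS _), annealedLaw]
  · intro w _
    exact (integrable_const (1 : ℝ)).indicator (hS w)

theorem abs_wordFreq_sub_update_le {J : Finset ℕ} (hJ : ∀ j ∈ J, 1 ≤ j) (i t : ℕ)
    (x : ℕ → Fin b) (a : Fin b) :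
    |wordFreq k J i x - wordFreq k J i (Function.update x t a)| ≤ 2 * k / (b : ℝ) ^ k := by
  classical
  set y := Function.update x t a with hy
  let block (z : ℕ → Fin b) (j : ℕ) : Fin k → Fin b := fun s => z (j - 1 + s)
  have hblock (z : ℕ → Fin b) (j : ℕ) (w : Fin k → Fin b) (h : OccursAt z j w) : block z j = w :=
    funext h
  set I := Finset.Icc (t + 2 - k) (t + 1) with hI
  set W : Finset (Fin k → Fin b) := I.image (block x) ∪ I.image (block y) with hW
  have hWcard : W.card ≤ 2 * k := by
    have h1 := Finset.card_union_le (I.image (block x)) (I.image (block y))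
    have h2 := Finset.card_image_le (s := I) (f := block x)
    have h3 := Finset.card_image_le (s := I) (f := block y)
    have h4 : I.card ≤ k := by rw [hI, Nat.card_Icc]; omega
    rw [hW]
    omega
  have hcount (w : Fin k → Fin b) (hw : w ∉ W) : occCount J x w = occCount J y w := by
    refine congrArg Finset.card (Finset.filter_congr fun j hj => ?_)
    by_cases hjI : j ∈ I
    · have hx : ¬ OccursAt x j w := fun h => hw
        (Finset.mem_union_left _ (Finset.mem_image.2 ⟨j, hjI, hblock x j w h⟩))
      have hy : ¬ OccursAt y j w := fun h => hw
        (Finset.mem_union_right _ (Finset.mem_image.2 ⟨j, hjI, hblock y j w h⟩))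
      exact iff_of_false hx hy
    · refine forall_congr' fun s => ?_
      have hne : j - 1 + s ≠ t := fun h => by
        have := hJ j hj
        have := s.2
        exact hjI (Finset.mem_Icc.2 (by omega))
      rw [hy, Function.update_of_ne hne]
  have hle (z z' : ℕ → Fin b) (h : ∀ w ∉ W, occCount J z w = occCount J z' w) :
      ((Finset.univ.filter fun w : Fin k → Fin b => occCount J z w = i).card : ℝ) ≤
        (Finset.univ.filter fun w : Fin k → Fin b => occCount J z' w = i).card + 2 * k := by
    have hsub : (Finset.univ.filter fun w : Fin k → Fin b => occCount J z w = i) ⊆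
        (Finset.univ.filter fun w : Fin k → Fin b => occCount J z' w = i) ∪ W := by
      intro w hw
      by_cases hwW : w ∈ W
      · exact Finset.mem_union_right _ hwW
      · simp only [Finset.mem_filter, Finset.mem_univ, true_and] at hw
        exact Finset.mem_union_left _ (by simpa [← h w hwW] using hw)
    have := (Finset.card_le_card hsub).trans (Finset.card_union_le _ _)
    exact_mod_cast this.trans (Nat.add_le_add_left hWcard _)
  have h1 := hle x y hcount
  have h2 := hle y x fun w hw => (hcount w hw).symm
  unfold wordFreq
  rw [← sub_div, abs_div, abs_of_nonneg (by positivity : (0 : ℝ) ≤ (b : ℝ) ^ k)]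
  gcongr
  rw [abs_le]
  constructor <;> linarith

theorem muK_toReal_eq_wordFreq {S : Set ℝ} {J : Finset ℕ} {x : ℕ → Fin b}
    (hJ : ∀ j, j ∈ J ↔ 1 ≤ j ∧ (j : ℝ) / (b : ℝ) ^ k ∈ S) (i : ℕ) :
    ((muK b k) {w : Fin k → Fin b | Mx b k S x w = i}).toReal = wordFreq k J i x := by
  have hM (w : Fin k → Fin b) : Mx b k S x w = occCount J x w := by
    unfold Mx occCount
    rw [← Set.ncard_coe_finset]
    congr 1
    ext j
    simp [hJ, and_assoc]
  have hset : {w : Fin k → Fin b | Mx b k S x w = i} =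
      ((Finset.univ.filter fun w : Fin k → Fin b => occCount J x w = i) : Set (Fin k → Fin b)) := by
    ext w
    simp [hM]
  rw [hset, muK, Measure.smul_apply, Measure.count_apply_finset, wordFreq]
  simp [div_eq_inv_mul]

end WordFrequency

section AlmostSure

/-- A sequence of random variables with summable variances is almost surely asymptotic to
its sequence of means. -/
theorem ae_tendsto_sub_mean_of_summable {α : Type*} [MeasurableSpace α] {ν : Measure α}
    {F : ℕ → α → ℝ} {v : ℕ → ℝ} {m : ℕ → ℝ} (hF : ∀ k, Measurable (F k))
    (hint : ∀ k, Integrable (fun x => (F k x - m k) ^ 2) ν)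
    (hv : ∀ k, ∫ x, (F k x - m k) ^ 2 ∂ν ≤ v k) (hs : Summable v) :
    ∀ᵐ x ∂ν, Tendsto (fun k => F k x - m k) atTop (𝓝 0) := by
  have hv0 (k : ℕ) : 0 ≤ v k := (integral_nonneg fun x => sq_nonneg _).trans (hv k)
  have hmeas (k : ℕ) : Measurable fun x => ENNReal.ofReal ((F k x - m k) ^ 2) :=
    (((hF k).sub_const _).pow_const 2).ennreal_ofReal
  have hfin : ∫⁻ x, ∑' k, ENNReal.ofReal ((F k x - m k) ^ 2) ∂ν ≠ ⊤ := by
    rw [lintegral_tsum fun k => (hmeas k).aemeasurable]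
    refine ne_top_of_le_ne_top hs.tsum_ofReal_ne_top (ENNReal.tsum_le_tsum fun k => ?_)
    rw [← ofReal_integral_eq_lintegral_ofReal (hint k) (ae_of_all _ fun x => sq_nonneg _)]
    exact ENNReal.ofReal_le_ofReal (hv k)
  filter_upwards [ae_lt_top (Measurable.tsum hmeas) hfin] with x hx
  have h0 := ENNReal.tendsto_atTop_zero_of_tsum_ne_top hx.ne
  have h1 : Tendsto (fun k => (F k x - m k) ^ 2) atTop (𝓝 0) := by
    have := (ENNReal.tendsto_toReal ENNReal.zero_ne_top).comp h0
    simpa [Function.comp_def, ENNReal.toReal_ofReal (sq_nonneg _)] using this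
  have h2 := h1.sqrt
  rw [Real.sqrt_zero] at h2
  simp only [Real.sqrt_sq_eq_abs] at h2
  exact (tendsto_zero_iff_abs_tendsto_zero _).2 h2

theorem IsUnifProductMeasure.ae_tendsto_wordFreq {b : ℕ} (hb : 2 ≤ b) {ν : Measure (ℕ → Fin b)}
    (hν : IsUnifProductMeasure b ν) {C : ℕ} {J : ℕ → Finset ℕ} (hJ : ∀ k, ∀ j ∈ J k, 1 ≤ j)
    (hJC : ∀ k, ∀ j ∈ J k, j ≤ C * b ^ k) {r : ℝ}
    (hr : Tendsto (fun k => ((J k).card : ℝ) / (b : ℝ) ^ k) atTop (𝓝 r)) (i : ℕ) :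
    ∀ᵐ x ∂ν, Tendsto (fun k => wordFreq k (J k) i x) atTop
      (𝓝 (Real.exp (-r) * r ^ i / (i.factorial : ℝ))) := by
  have := hν.isProbabilityMeasure
  have hb1 : (1 : ℝ) < b := by exact_mod_cast hb
  have hinv : ‖(b : ℝ)⁻¹‖ < 1 := by
    rw [Real.norm_of_nonneg (by positivity)]
    exact inv_lt_one_of_one_lt₀ hb1
  have hp : Tendsto (fun k => 1 / (b : ℝ) ^ k) atTop (𝓝 0) := by
    simpa [one_div] using tendsto_pow_atTop_nhds_zero_of_norm_lt_one hinv
  have hkp : Tendsto (fun k : ℕ => (k : ℝ) * (1 / (b : ℝ) ^ k)) atTop (𝓝 0) := by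
    simpa [one_div] using tendsto_self_mul_const_pow_of_abs_lt_one (r := (b : ℝ)⁻¹) hinv
  have hr' : Tendsto (fun k => ((J k).card : ℝ) * (1 / (b : ℝ) ^ k)) atTop (𝓝 r) := by
    simpa [div_eq_mul_inv] using hr
  have hmean : Tendsto (fun k => annealedLaw ν k (J k) i) atTop
      (𝓝 (Real.exp (-r) * r ^ i / (i.factorial : ℝ))) := by
    have h1 := tendsto_binomialMass (fun k => by positivity) hp hr' i
    have h2 : Tendsto (fun k => annealedLaw ν k (J k) i -
        binomialMass (1 / (b : ℝ) ^ k) (J k).card i) atTop (𝓝 0) := by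
      refine squeeze_zero_norm
        (fun k => hν.abs_annealedLaw_sub_binomialMass_le (k := k) (J k) (hJ k) i) ?_
      have h3 := (hr'.mul hkp).const_mul 4
      simp only [mul_zero] at h3
      refine h3.congr fun k => ?_
      ring
    simpa using h2.add h1
  have hdep (k : ℕ) : DependsOn (wordFreq (b := b) k (J k) i) (Set.Iio (C * b ^ k + k)) :=
    dependsOn_wordFreq (fun j hj => by have := hJC k j hj; omega) i
  have hvar (k : ℕ) : ∫ x, (wordFreq k (J k) i x - annealedLaw ν k (J k) i) ^ 2 ∂ν ≤
      4 * (C + 1) * ((k : ℝ) ^ 2 * (b : ℝ)⁻¹ ^ k) := by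
    have h := hν.integral_sq_sub_mean_le (hdep k)
      fun t x a => abs_wordFreq_sub_update_le (hJ k) i t x a
    rw [hν.integral_wordFreq] at h
    refine h.trans ?_
    have hk : (k : ℝ) ≤ (b : ℝ) ^ k := by exact_mod_cast (Nat.lt_pow_self hb).le
    have hN : ((C * b ^ k + k : ℕ) : ℝ) ≤ (C + 1) * (b : ℝ) ^ k := by
      push_cast
      linarith
    refine (mul_le_mul_of_nonneg_right hN (sq_nonneg _)).trans (le_of_eq ?_)
    rw [inv_pow]
    field_simp
    ring
  have hint (k : ℕ) :
      Integrable (fun x => (wordFreq k (J k) i x - annealedLaw ν k (J k) i) ^ 2) ν := by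
    refine Integrable.of_bound
      (((hdep k).measurable_of_Iio.sub_const _).pow_const 2).aestronglyMeasurable
      ((1 + |annealedLaw ν k (J k) i|) ^ 2) (ae_of_all _ fun x => ?_)
    rw [norm_pow]
    gcongr
    refine (norm_sub_le _ _).trans (add_le_add_left ?_ _)
    rw [Real.norm_of_nonneg (by unfold wordFreq; positivity), wordFreq, div_le_one (by positivity)]
    have := Finset.card_filter_le (Finset.univ : Finset (Fin k → Fin b))
      fun w => occCount (J k) x w = i
    rw [Finset.card_univ, Fintype.card_fun, Fintype.card_fin, Fintype.card_fin] at this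
    exact_mod_cast this
  have hsum : Summable fun k : ℕ => 4 * (C + 1) * ((k : ℝ) ^ 2 * (b : ℝ)⁻¹ ^ k) :=
    (summable_pow_mul_geometric_of_norm_lt_one 2 hinv).mul_left _
  filter_upwards [ae_tendsto_sub_mean_of_summable (fun k => (hdep k).measurable_of_Iio) hint hvar
    hsum] with x hx
  simpa using hx.add hmean

end AlmostSure

section Intervals

/-- The number of natural numbers in an open interval is its length up to an error of `1`. -/
theorem abs_card_sub_length_le {s t : ℝ} (hs : 0 ≤ s) (I : Finset ℕ)
    (hI : ∀ j, j ∈ I ↔ 1 ≤ j ∧ s < j ∧ (j : ℝ) < t) : |(I.card : ℝ) - max (t - s) 0| ≤ 1 := by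
  have hIoo : I = Finset.Ioo ⌊s⌋₊ ⌈t⌉₊ := by
    ext j
    rw [hI, Finset.mem_Ioo, Nat.floor_lt hs, Nat.lt_ceil]
    refine ⟨fun h => h.2, fun h => ⟨?_, h⟩⟩
    have : (0 : ℝ) < j := hs.trans_lt h.1
    exact_mod_cast this
  have h1 := Nat.floor_le hs
  have h2 := Nat.lt_floor_add_one s
  have h3 := Nat.le_ceil t
  rw [hIoo, Nat.card_Ioo]
  rcases le_or_gt t s with hts | hts
  · rw [max_eq_right (by linarith)]
    have : ⌈t⌉₊ ≤ ⌊s⌋₊ + 1 := Nat.ceil_le.2 (by push_cast; linarith)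
    rw [Nat.sub_sub, Nat.sub_eq_zero_of_le this]
    simp
  · rw [max_eq_left (by linarith)]
    have h4 := Nat.ceil_lt_add_one (hs.trans hts.le)
    have h5 : ⌊s⌋₊ + 1 ≤ ⌈t⌉₊ := Nat.lt_ceil.2 (h1.trans_lt hts)
    rw [Nat.sub_sub, Nat.cast_sub h5, abs_le]
    push_cast
    constructor <;> linarith

variable {n : ℕ} {p q : Fin n → ℚ}

theorem toReal_volume_iUnion_Ioo
    (hd : Pairwise fun m l : Fin n =>
      Disjoint (Set.Ioo (p m : ℝ) (q m : ℝ)) (Set.Ioo (p l : ℝ) (q l : ℝ))) :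
    (volume (⋃ m, Set.Ioo (p m : ℝ) (q m : ℝ))).toReal = ∑ m, max ((q m : ℝ) - p m) 0 := by
  rw [measure_iUnion hd fun m => measurableSet_Ioo, tsum_fintype,
    ENNReal.toReal_sum fun m _ => by simp]
  exact Finset.sum_congr rfl fun m _ => by rw [Real.volume_Ioo, ENNReal.toReal_ofReal']

theorem tendsto_card_div_pow {b : ℕ} (hb : 2 ≤ b) (hp : ∀ m, 0 ≤ p m)
    (hd : Pairwise fun m l : Fin n =>
      Disjoint (Set.Ioo (p m : ℝ) (q m : ℝ)) (Set.Ioo (p l : ℝ) (q l : ℝ)))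
    {J : ℕ → Finset ℕ}
    (hJ : ∀ k j, j ∈ J k ↔
      1 ≤ j ∧ (j : ℝ) / (b : ℝ) ^ k ∈ ⋃ m, Set.Ioo (p m : ℝ) (q m : ℝ)) :
    Tendsto (fun k => ((J k).card : ℝ) / (b : ℝ) ^ k) atTop
      (𝓝 (volume (⋃ m, Set.Ioo (p m : ℝ) (q m : ℝ))).toReal) := by
  classical
  rw [toReal_volume_iUnion_Ioo hd]
  have hb1 : (1 : ℝ) < b := by exact_mod_cast hb
  have hcard (k : ℕ) : |((J k).card : ℝ) / (b : ℝ) ^ k - ∑ m, max ((q m : ℝ) - p m) 0| ≤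
      n * (1 / (b : ℝ) ^ k) := by
    have hbk : (0 : ℝ) < (b : ℝ) ^ k := by positivity
    set I : Fin n → Finset ℕ := fun m =>
      (J k).filter fun j => (j : ℝ) / (b : ℝ) ^ k ∈ Set.Ioo (p m : ℝ) (q m : ℝ) with hI
    have hunion : J k = Finset.univ.biUnion I := by
      ext j
      simp only [hI, Finset.mem_biUnion, Finset.mem_univ, true_and, Finset.mem_filter]
      refine ⟨fun h => ?_, fun ⟨m, h, _⟩ => h⟩
      obtain ⟨m, hm⟩ := Set.mem_iUnion.1 ((hJ k j).1 h).2
      exact ⟨m, h, hm⟩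
    have hdisj : Set.PairwiseDisjoint (Finset.univ : Finset (Fin n)) I := by
      intro m _ l _ hml
      refine Finset.disjoint_left.2 fun j hj hj' => ?_
      exact Set.disjoint_left.1 (hd hml) (Finset.mem_filter.1 hj).2 (Finset.mem_filter.1 hj').2
    have hIcard (m : Fin n) :
        |((I m).card : ℝ) / (b : ℝ) ^ k - max ((q m : ℝ) - p m) 0| ≤ 1 / (b : ℝ) ^ k := by
      have h := abs_card_sub_length_le (s := p m * (b : ℝ) ^ k) (t := q m * (b : ℝ) ^ k)
        (mul_nonneg (by exact_mod_cast hp m) hbk.le) (I m) fun j => by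
          simp only [hI, Finset.mem_filter, Set.mem_Ioo, lt_div_iff₀ hbk, div_lt_iff₀ hbk]
          refine ⟨fun h => ⟨((hJ k j).1 h.1).1, h.2⟩, fun h => ⟨(hJ k j).2 ⟨h.1, ?_⟩, h.2⟩⟩
          exact Set.mem_iUnion.2 ⟨m, (lt_div_iff₀ hbk).2 h.2.1, (div_lt_iff₀ hbk).2 h.2.2⟩
      have hmax : max (q m * (b : ℝ) ^ k - p m * (b : ℝ) ^ k) 0 =
          max ((q m : ℝ) - p m) 0 * (b : ℝ) ^ k := by
        rw [max_mul_of_nonneg _ _ hbk.le, sub_mul, zero_mul]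
      rw [hmax] at h
      rw [le_div_iff₀ hbk, ← abs_of_pos hbk, ← abs_mul, abs_of_pos hbk, sub_mul,
        div_mul_cancel₀ _ hbk.ne']
      exact h
    rw [hunion, Finset.card_biUnion fun m _ l _ hml => hdisj (by simp) (by simp) hml]
    push_cast
    rw [Finset.sum_div, ← Finset.sum_sub_distrib]
    refine (Finset.abs_sum_le_sum_abs _ _).trans
      ((Finset.sum_le_card_nsmul _ _ _ fun m _ => hIcard m).trans (le_of_eq ?_))
    simp
  have hz : Tendsto (fun k => (n : ℝ) * (1 / (b : ℝ) ^ k)) atTop (𝓝 0) := by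
    have : ‖(b : ℝ)⁻¹‖ < 1 := by
      rw [Real.norm_of_nonneg (by positivity)]
      exact inv_lt_one_of_one_lt₀ hb1
    simpa [one_div] using (tendsto_pow_atTop_nhds_zero_of_norm_lt_one this).const_mul (n : ℝ)
  exact tendsto_sub_nhds_zero_iff.1 (squeeze_zero_norm hcard hz)

theorem exists_nat_upper_bound (q : Fin n → ℚ) : ∃ C : ℕ, ∀ m, (q m : ℝ) ≤ C := by
  obtain ⟨M, hM⟩ := (Set.finite_range fun m => (q m : ℝ)).bddAbove
  obtain ⟨C, hC⟩ := exists_nat_ge M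
  exact ⟨C, fun m => (hM ⟨m, rfl⟩).trans hC⟩

end Intervals

theorem stmt1 (b : ℕ) (hb : 2 ≤ b) (ν : Measure (ℕ → Fin b))
    (hν : IsUnifProductMeasure b ν) :
    ∀ᵐ x ∂ν, ∀ S : Set ℝ, IsFinRatIntervalUnion S → ∀ i : ℕ,
      Tendsto (fun k : ℕ => ((muK b k) {w : Fin k → Fin b | Mx b k S x w = i}).toReal)
        atTop
        (nhds (Real.exp (-(volume S).toReal) * (volume S).toReal ^ i /
          (Nat.factorial i : ℝ))) := by
  have key : ∀ᵐ x ∂ν, ∀ (n : ℕ) (p q : Fin n → ℚ) (i : ℕ), (∀ m, 0 ≤ p m) →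
      (Pairwise fun m l : Fin n =>
        Disjoint (Set.Ioo (p m : ℝ) (q m : ℝ)) (Set.Ioo (p l : ℝ) (q l : ℝ))) →
      Tendsto (fun k : ℕ => ((muK b k) {w : Fin k → Fin b |
        Mx b k (⋃ m, Set.Ioo (p m : ℝ) (q m : ℝ)) x w = i}).toReal) atTop
        (𝓝 (Real.exp (-(volume (⋃ m, Set.Ioo (p m : ℝ) (q m : ℝ))).toReal) *
          (volume (⋃ m, Set.Ioo (p m : ℝ) (q m : ℝ))).toReal ^ i / (i.factorial : ℝ))) := by
    simp only [ae_all_iff]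
    intro n p q i hp hd
    classical
    obtain ⟨C, hC⟩ := exists_nat_upper_bound q
    have hbpos : (0 : ℝ) < b := by exact_mod_cast (by omega : 0 < b)
    let J : ℕ → Finset ℕ := fun k => (Finset.Icc 1 (C * b ^ k)).filter fun j =>
      (j : ℝ) / (b : ℝ) ^ k ∈ ⋃ m, Set.Ioo (p m : ℝ) (q m : ℝ)
    have hJ (k j : ℕ) : j ∈ J k ↔
        1 ≤ j ∧ (j : ℝ) / (b : ℝ) ^ k ∈ ⋃ m, Set.Ioo (p m : ℝ) (q m : ℝ) := by
      simp only [J, Finset.mem_filter, Finset.mem_Icc]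
      refine ⟨fun h => ⟨h.1.1, h.2⟩, fun h => ⟨⟨h.1, ?_⟩, h.2⟩⟩
      obtain ⟨m, hm⟩ := Set.mem_iUnion.1 h.2
      have h1 := (hm.2.trans_le (hC m)).le
      rw [div_le_iff₀ (by positivity)] at h1
      exact_mod_cast h1
    filter_upwards [hν.ae_tendsto_wordFreq hb (C := C) (fun k j hj => ((hJ k j).1 hj).1)
      (fun k j hj => (Finset.mem_Icc.1 (Finset.mem_filter.1 hj).1).2)
      (tendsto_card_div_pow hb hp hd hJ) i] with x hx
    exact hx.congr fun k => (muK_toReal_eq_wordFreq (hJ k) i).symm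
  filter_upwards [key] with x hx
  rintro S ⟨n, p, q, hp, hd, rfl⟩ i
  exact hx n p q i hp hd
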